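/- Let G be the simple graph on six vertices v1,...,v6 whose edges are the path edges v1v2, v2v3, v3v4, v4v5, v5v6 together with the chords v2v4, v3v5 and v4v6 (this is the graph G^6_98 in Harary's enumeration of six-vertex graphs). Then for every integer n ≥ 5, the crossing number of the Cartesian product G □ C_n equals 3n. -/

import Mathlib

open SimpleGraph

/-- A drawing of a simple graph in the plane: vertices are mapped to distinct
points, and each edge is mapped to a simple arc (parametrised by `[0,1]`)
joining the images of its endpoints and avoiding the images of all vertices
in its interior. -/
structure Drawing {V : Type*} (G : SimpleGraph V) where
  vertexMap : V → ℝ × ℝ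
  vertexMap_injective : Function.Injective vertexMap
  arc : G.edgeSet → ℝ → ℝ × ℝ
  arc_continuousOn : ∀ e, ContinuousOn (arc e) (Set.Icc 0 1)
  arc_injOn : ∀ e, Set.InjOn (arc e) (Set.Icc 0 1)
  arc_endpoints : ∀ e : G.edgeSet, ∃ u v : V,
    (e : Sym2 V) = s(u, v) ∧ arc e 0 = vertexMap u ∧ arc e 1 = vertexMap v
  arc_avoids_vertices : ∀ e : G.edgeSet, ∀ t ∈ Set.Ioo (0 : ℝ) 1, ∀ w : V,
    arc e t ≠ vertexMap w

/-- The crossings of a drawing: an unordered pair of distinct edges together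
with a point of the plane where the two corresponding arcs intersect away
from their endpoints. -/
def Drawing.crossings {V : Type*} {G : SimpleGraph V} (D : Drawing G) :
    Set (Sym2 G.edgeSet × (ℝ × ℝ)) :=
  { x | ∃ e f : G.edgeSet, e ≠ f ∧ x.1 = s(e, f) ∧
      (∃ s ∈ Set.Ioo (0 : ℝ) 1, D.arc e s = x.2) ∧
      (∃ t ∈ Set.Ioo (0 : ℝ) 1, D.arc f t = x.2) }

/-- The crossing number of a simple graph: the minimum number of crossings
over all drawings of the graph in the plane. -/
noncomputable def crossingNumber {V : Type*} (G : SimpleGraph V) : ℕ :=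
  sInf { n : ℕ | ∃ D : Drawing G, D.crossings.Finite ∧ D.crossings.ncard = n }

/-- The graph `G⁶₉₈`: the path `v1 v2 v3 v4 v5 v6` together with the chords `v2v4`, `v3v5` and `v4v6`. -/
def G6_98 : SimpleGraph (Fin 6) :=
  SimpleGraph.fromEdgeSet {s(0, 1), s(1, 2), s(2, 3), s(3, 4), s(4, 5), s(1, 3), s(2, 4), s(3, 5)}

theorem exists_continuous_exp_eq {X : Type*} [TopologicalSpace X] [LocallyPathConnectedSpace X]
    [SimplyConnectedSpace X] {g : X → ℂ} (hg : Continuous g) (h0 : ∀ x, g x ≠ 0) :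
    ∃ f : X → ℂ, Continuous f ∧ ∀ x, Complex.exp (f x) = g x := by
  obtain ⟨x₀⟩ : Nonempty X := inferInstance
  obtain ⟨f, ⟨-, hf⟩, -⟩ := Complex.isCoveringMapOn_exp.existsUnique_continuousMap_lifts
    ⟨g, hg⟩ (Complex.exp_log (h0 x₀)) h0
  exact ⟨f, f.continuous, fun x => congrFun hf x⟩

theorem sub_eq_sub_of_exp_eq {f g : ℝ → ℂ} (hf : Continuous f) (hg : Continuous g) {c : ℂ}
    (h : ∀ t, Complex.exp (f t) = Complex.exp (g t + c)) (a b : ℝ) :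
    f b - f a = g b - g a := by
  have hint : ∀ t, ∃ k : ℤ, f t = g t + c + k * (2 * Real.pi * Complex.I) :=
    fun t => Complex.exp_eq_exp_iff_exists_int.mp (h t)
  choose k hk using hint
  have hk' : ∀ t, ((k t : ℝ) : ℂ) = (f t - g t - c) / (2 * Real.pi * Complex.I) := by
    intro t
    rw [eq_div_iff Complex.two_pi_I_ne_zero, hk t]
    push_cast
    ring
  have hkc : Continuous k := by
    rw [Int.isClosedEmbedding_coe_real.isInducing.continuous_iff]
    have : Continuous fun t => ((f t - g t - c) / (2 * Real.pi * Complex.I)).re := by fun_prop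
    refine this.congr fun t => ?_
    rw [← hk', Complex.ofReal_re]
    rfl
  have hconst : k b = k a := PreconnectedSpace.constant inferInstance hkc
  rw [hk a, hk b, hconst]
  ring

theorem exists_log_difference {W : Type*} (p : W → ℂ) (hp : Function.Injective p) (rank : W → ℕ)
    (hrank : Function.Injective rank) :
    ∃ L : W → W → ℂ, (∀ u v, u ≠ v → Complex.exp (L u v) = p u - p v) ∧
      ∀ u v, u ≠ v → L u v - L v u =
        (1 - 2 * (if rank u < rank v then 1 else 0 : ℤ)) * (Real.pi * Complex.I) := by
  have hsub : ∀ u v, u ≠ v → p u - p v ≠ 0 := fun u v h => sub_ne_zero.mpr (hp.ne h)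
  refine ⟨fun u v => if rank u < rank v then Complex.log (p u - p v)
    else Complex.log (p v - p u) + Real.pi * Complex.I, fun u v huv => ?_, fun u v huv => ?_⟩
  · dsimp only
    split_ifs
    · exact Complex.exp_log (hsub u v huv)
    · rw [Complex.exp_add, Complex.exp_log (hsub v u huv.symm), Complex.exp_pi_mul_I]
      ring
  · rcases lt_or_gt_of_ne (hrank.ne huv) with h | h
    · simp only [h, if_true, h.not_gt, if_false]
      push_cast
      ring
    · simp only [h, if_true, h.not_gt, if_false]
      push_cast
      ring

/-- Two paths whose ranges are disjoint have algebraic intersection number zero; here the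
intersection number is written as a correction of the interleaving number of the end points by
the winding numbers `M` of the paths around the end points of the others. -/
theorem exists_winding_numbers {W E : Type*} (p : W → ℂ) (hp : Function.Injective p)
    (rank : W → ℕ) (hrank : Function.Injective rank) (src tgt : E → W)
    (γ : ∀ e, Path (p (src e)) (p (tgt e))) :
    ∃ M : E → W → ℤ, ∀ e f, Disjoint (Set.range (γ e)) (Set.range (γ f)) →
      M e (src f) - M e (tgt f) + M f (tgt e) - M f (src e) =
        (if rank (tgt e) < rank (src f) then 1 else 0)
        - (if rank (src e) < rank (src f) then 1 else 0)
        - (if rank (tgt e) < rank (tgt f) then 1 else 0)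
        + (if rank (src e) < rank (tgt f) then 1 else 0) := by
  obtain ⟨L, hL, hLL⟩ := exists_log_difference p hp rank hrank
  have hne : ∀ e v, p v ∉ Set.range (γ e) → src e ≠ v ∧ tgt e ≠ v := by
    refine fun e v h => ⟨?_, ?_⟩
    · rintro rfl
      exact h ⟨0, (γ e).source⟩
    · rintro rfl
      exact h ⟨1, (γ e).target⟩
  have hM : ∀ e v, ∃ m : ℤ, p v ∉ Set.range (γ e) → ∀ g : ℝ → ℂ, Continuous g → ∀ c : ℂ,
      (∀ t, Complex.exp (g t + c) = (γ e).extend t - p v) →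
      g 1 - g 0 = L (tgt e) v - L (src e) v + m * (2 * Real.pi * Complex.I) := by
    intro e v
    by_cases h : p v ∉ Set.range (γ e)
    swap
    · exact ⟨0, fun h' => absurd h' h⟩
    have h0 : ∀ t : ℝ, (γ e).extend t - p v ≠ 0 := by
      intro t ht
      refine h ?_
      rw [← (γ e).extend_range]
      exact ⟨t, sub_eq_zero.mp ht⟩
    obtain ⟨g₀, hg₀, hexp⟩ := exists_continuous_exp_eq (X := ℝ)
      (g := fun t => (γ e).extend t - p v) (by fun_prop) h0
    have h1 : Complex.exp (g₀ 1 - g₀ 0) = Complex.exp (L (tgt e) v - L (src e) v) := by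
      rw [Complex.exp_sub, Complex.exp_sub, hexp, hexp, hL _ _ (hne e v h).1,
        hL _ _ (hne e v h).2]
      simp
    obtain ⟨m, hm⟩ := Complex.exp_eq_exp_iff_exists_int.mp h1
    refine ⟨m, fun _ g hg c hgc => ?_⟩
    rw [← hm]
    refine (sub_eq_sub_of_exp_eq hg₀ hg (c := c) (fun t => ?_) 0 1).symm
    rw [hexp, hgc]
  choose M hM using hM
  refine ⟨M, fun e f hd => ?_⟩
  have mem_src : ∀ e, p (src e) ∈ Set.range (γ e) := fun e => ⟨0, (γ e).source⟩
  have mem_tgt : ∀ e, p (tgt e) ∈ Set.range (γ e) := fun e => ⟨1, (γ e).target⟩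
  have hsf := Set.disjoint_right.mp hd (mem_src f)
  have htf := Set.disjoint_right.mp hd (mem_tgt f)
  have hse := Set.disjoint_left.mp hd (mem_src e)
  have hte := Set.disjoint_left.mp hd (mem_tgt e)
  have h0 : ∀ z : ℝ × ℝ, (γ e).extend z.1 - (γ f).extend z.2 ≠ 0 := by
    intro z hz
    have h1 : (γ e).extend z.1 ∈ Set.range (γ e) := by
      rw [← (γ e).extend_range]
      exact ⟨_, rfl⟩
    refine Set.disjoint_left.mp hd h1 ?_
    rw [sub_eq_zero.mp hz, ← (γ f).extend_range]
    exact ⟨_, rfl⟩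
  obtain ⟨g, hg, hexp⟩ := exists_continuous_exp_eq (X := ℝ × ℝ)
    (g := fun z => (γ e).extend z.1 - (γ f).extend z.2) (by fun_prop) h0
  have e1 := hM e (src f) hsf (fun t => g (t, 0)) (by fun_prop) 0 (fun t => by simp [hexp])
  have e2 := hM e (tgt f) htf (fun t => g (t, 1)) (by fun_prop) 0 (fun t => by simp [hexp])
  have e3 := hM f (src e) hse (fun t => g (0, t)) (by fun_prop) (Real.pi * Complex.I)
    (fun t => by simp [Complex.exp_add, hexp])
  have e4 := hM f (tgt e) hte (fun t => g (1, t)) (by fun_prop) (Real.pi * Complex.I)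
    (fun t => by simp [Complex.exp_add, hexp])
  have l1 := hLL (src e) (src f) (hne e _ hsf).1
  have l2 := hLL (src e) (tgt f) (hne e _ htf).1
  have l3 := hLL (tgt e) (src f) (hne e _ hsf).2
  have l4 := hLL (tgt e) (tgt f) (hne e _ htf).2
  have key : ((M e (src f) - M e (tgt f) + M f (tgt e) - M f (src e) : ℤ) : ℂ)
        * (2 * Real.pi * Complex.I) =
      (((if rank (tgt e) < rank (src f) then 1 else 0)
        - (if rank (src e) < rank (src f) then 1 else 0)
        - (if rank (tgt e) < rank (tgt f) then 1 else 0)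
        + (if rank (src e) < rank (tgt f) then 1 else 0) : ℤ) : ℂ)
        * (2 * Real.pi * Complex.I) := by
    push_cast at l1 l2 l3 l4 ⊢
    linear_combination e2 - e1 + e3 - e4 + l1 - l2 - l3 + l4
  exact_mod_cast mul_right_cancel₀ Complex.two_pi_I_ne_zero key

/-- The pairs consisting of an edge of `K` and an end point of its partner. -/
def incidences {W E : Type*} (src tgt : E → W) (K : List (E × E)) : List (E × W) :=
  K.flatMap fun q => [(q.1, src q.2), (q.1, tgt q.2), (q.2, src q.1), (q.2, tgt q.1)]

/-- Parity determines whether two chords of a convex polygon whose vertices are ordered by `rank`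
cross. -/
def interleaving {W E : Type*} (rank : W → ℕ) (src tgt : E → W) (q : E × E) : ℕ :=
  (if rank (tgt q.1) < rank (src q.2) then 1 else 0)
    + (if rank (src q.1) < rank (src q.2) then 1 else 0)
    + (if rank (tgt q.1) < rank (tgt q.2) then 1 else 0)
    + (if rank (src q.1) < rank (tgt q.2) then 1 else 0)

/-- A list of pairs of edges that contains an odd number of crossing pairs in every drawing. -/
def IsOddCheck {W E : Type*} [DecidableEq W] [DecidableEq E] (rank : W → ℕ) (src tgt : E → W)
    (K : List (E × E)) : Prop :=
  (∀ x ∈ incidences src tgt K, Even ((incidences src tgt K).count x)) ∧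
    Odd ((K.map (interleaving rank src tgt)).sum)

theorem List.sum_map_eq_zero_of_even_count {α R : Type*} [DecidableEq α] [CommRing R] [CharP R 2]
    (l : List α) (h : ∀ x ∈ l, Even (l.count x)) (f : α → R) : (l.map f).sum = 0 := by
  rw [Finset.sum_list_map_count]
  refine Finset.sum_eq_zero fun x hx => ?_
  rw [nsmul_eq_mul, (CharP.cast_eq_zero_iff R 2 _).mpr (h x (List.mem_toFinset.mp hx)).two_dvd,
    zero_mul]

theorem IsOddCheck.exists_not_disjoint_range {W E : Type*} [DecidableEq W] [DecidableEq E]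
    {rank : W → ℕ} {src tgt : E → W} {K : List (E × E)} (hK : IsOddCheck rank src tgt K)
    (hrank : Function.Injective rank) {p : W → ℂ} (hp : Function.Injective p)
    (γ : ∀ e, Path (p (src e)) (p (tgt e))) :
    ∃ q ∈ K, ¬ Disjoint (Set.range (γ q.1)) (Set.range (γ q.2)) := by
  by_contra! hdisj
  obtain ⟨M, hM⟩ := exists_winding_numbers p hp rank hrank src tgt γ
  have h1 : ∀ q ∈ K, (interleaving rank src tgt q : ZMod 2) =
      ([(q.1, src q.2), (q.1, tgt q.2), (q.2, src q.1), (q.2, tgt q.1)].map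
        fun x => (M x.1 x.2 : ZMod 2)).sum := by
    intro q hq
    have h := congrArg (Int.cast : ℤ → ZMod 2) (hM q.1 q.2 (hdisj q hq))
    push_cast at h
    simp only [CharTwo.sub_eq_add] at h
    simp only [interleaving, List.map_cons, List.map_nil, List.sum_cons, List.sum_nil]
    push_cast
    rw [← h]
    ring
  have h2 : ((K.map (interleaving rank src tgt)).sum : ZMod 2) =
      ((incidences src tgt K).map fun x => (M x.1 x.2 : ZMod 2)).sum := by
    rw [Nat.cast_list_sum, List.map_map, incidences, List.map_flatMap, List.flatMap,
      List.sum_flatten, List.map_map]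
    exact congrArg List.sum (List.map_congr_left h1)
  rw [List.sum_map_eq_zero_of_even_count _ fun x hx => by convert hK.1 x hx,
    ZMod.natCast_eq_zero_iff_even] at h2
  exact Nat.not_even_iff_odd.mpr hK.2 h2

theorem IsOddCheck.exists_not_disjoint {W E : Type*} [DecidableEq W] [DecidableEq E]
    {rank : W → ℕ} {src tgt : E → W} {K : List (E × E)} (hK : IsOddCheck rank src tgt K)
    (hrank : Function.Injective rank) {p : W → ℝ × ℝ} (hp : Function.Injective p)
    {S : E → Set (ℝ × ℝ)} (hS : ∀ e, JoinedIn (S e) (p (src e)) (p (tgt e))) :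
    ∃ q ∈ K, ¬ Disjoint (S q.1) (S q.2) := by
  let φ := Complex.equivRealProdCLM.symm
  obtain ⟨q, hq, h⟩ := hK.exists_not_disjoint_range hrank (p := φ ∘ p)
    (φ.injective.comp hp) (fun e => (hS e).somePath.map φ.continuous)
  refine ⟨q, hq, fun hd => h ?_⟩
  rw [Set.disjoint_left] at hd ⊢
  rintro _ ⟨s, rfl⟩ ⟨t, ht⟩
  refine hd ((hS q.1).somePath_mem s) ?_
  rw [← φ.injective ht]
  exact (hS q.2).somePath_mem t

/-- The path edges, the chords and the links of a layer, in this order, by the row of their first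
end point. -/
def srcRow (t : Fin 14) : Fin 6 := ![0, 1, 2, 3, 4, 1, 2, 3, 0, 1, 2, 3, 4, 5] t

/-- The row of the second end point of an edge. -/
def tgtRow (t : Fin 14) : Fin 6 := ![1, 2, 3, 4, 5, 3, 4, 5, 0, 1, 2, 3, 4, 5] t

/-- Rotation of the cycle by `k` steps. -/
def rotate {n : ℕ} (i : Fin n) (k : ℕ) : Fin n := ⟨(i + k) % n, Nat.mod_lt _ i.pos⟩

/-- The first end point of an edge of `G6_98 □ cycleGraph n`. -/
def labelSrc {n : ℕ} (l : Fin 14 × Fin n) : Fin 6 × Fin n := (srcRow l.1, l.2)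

/-- The second end point of an edge of `G6_98 □ cycleGraph n`. -/
def labelTgt {n : ℕ} (l : Fin 14 × Fin n) : Fin 6 × Fin n :=
  (tgtRow l.1, rotate l.2 (if l.1 < 8 then 0 else 1))

/-- The order of the vertices of `G6_98 □ cycleGraph 3` used by the odd checks. -/
def windowRank (v : Fin 6 × Fin 3) : ℕ := 3 * v.1 + v.2

/-- Six odd checks of `G6_98 □ cycleGraph 3`. -/
def oddChecks : List (List ((Fin 14 × Fin 3) × Fin 14 × Fin 3)) :=
  [[((1, 0), 1, 2), ((1, 0), 3, 1), ((1, 0), 5, 1), ((1, 0), 6, 2), ((1, 0), 9, 1),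
    ((1, 0), 12, 1), ((1, 1), 1, 2), ((1, 1), 3, 1), ((1, 1), 5, 0), ((1, 1), 6, 2),
    ((1, 1), 0, 0), ((1, 1), 0, 2), ((1, 1), 11, 0), ((1, 1), 12, 1), ((8, 2), 1, 1),
    ((1, 2), 5, 0), ((5, 1), 1, 2), ((1, 2), 10, 0), ((1, 2), 11, 0), ((3, 1), 9, 0),
    ((3, 1), 10, 0), ((4, 1), 0, 0), ((4, 1), 0, 2), ((4, 1), 9, 0), ((4, 1), 9, 1),
    ((8, 2), 4, 1), ((5, 0), 9, 1), ((5, 0), 10, 1), ((5, 1), 0, 0), ((5, 1), 0, 2),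
    ((5, 1), 10, 0), ((5, 1), 10, 1), ((8, 2), 5, 1), ((6, 1), 0, 0), ((6, 1), 0, 2),
    ((6, 1), 9, 0), ((6, 1), 9, 1), ((8, 2), 6, 1), ((6, 2), 9, 0), ((6, 2), 10, 0),
    ((7, 1), 0, 0), ((7, 1), 0, 2), ((7, 1), 9, 0), ((7, 1), 9, 1), ((8, 2), 7, 1),
    ((9, 0), 10, 1), ((9, 0), 12, 1), ((9, 1), 10, 0), ((9, 1), 11, 0), ((10, 0), 12, 1),
    ((10, 1), 11, 0)],
   [((1, 0), 2, 1), ((1, 0), 4, 1), ((6, 1), 1, 0), ((1, 0), 7, 1), ((1, 2), 2, 1), ((1, 2), 4, 1),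
    ((1, 2), 6, 1), ((1, 2), 7, 1), ((2, 0), 2, 1), ((2, 0), 3, 2), ((2, 0), 6, 1),
    ((2, 0), 11, 1), ((2, 0), 12, 1), ((2, 2), 2, 1), ((2, 1), 3, 2), ((2, 1), 4, 1),
    ((2, 1), 7, 0), ((2, 1), 0, 0), ((2, 1), 0, 2), ((2, 1), 12, 1), ((2, 1), 13, 0),
    ((8, 2), 2, 1), ((2, 2), 4, 1), ((2, 2), 6, 1), ((7, 1), 2, 2), ((3, 2), 7, 0), ((3, 2), 7, 1),
    ((3, 2), 10, 0), ((3, 2), 13, 0), ((0, 0), 4, 1), ((0, 2), 4, 1), ((4, 1), 10, 0),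
    ((4, 1), 11, 1), ((4, 1), 8, 2), ((6, 0), 7, 1), ((6, 0), 7, 2), ((6, 0), 11, 1),
    ((6, 0), 13, 1), ((6, 1), 7, 0), ((7, 2), 6, 1), ((0, 0), 6, 1), ((0, 2), 6, 1),
    ((6, 1), 13, 0), ((6, 1), 13, 1), ((6, 1), 8, 2), ((7, 0), 11, 1), ((7, 0), 12, 1),
    ((0, 0), 7, 1), ((0, 2), 7, 1), ((7, 1), 12, 0), ((7, 1), 12, 1), ((7, 1), 8, 2),
    ((7, 2), 10, 0), ((7, 2), 12, 0), ((12, 1), 10, 0), ((10, 0), 13, 1), ((11, 1), 12, 0),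
    ((11, 1), 13, 0), ((12, 0), 13, 1), ((12, 1), 13, 0)],
   [((1, 0), 7, 0), ((7, 1), 1, 0), ((1, 0), 11, 0), ((1, 0), 13, 0), ((2, 0), 5, 1),
    ((2, 0), 5, 2), ((2, 0), 7, 1), ((2, 0), 7, 2), ((2, 0), 9, 1), ((2, 0), 13, 1),
    ((3, 1), 5, 0), ((3, 1), 5, 2), ((7, 0), 3, 1), ((3, 1), 7, 2), ((9, 0), 3, 1), ((3, 1), 9, 1),
    ((3, 1), 13, 0), ((3, 1), 13, 1), ((4, 1), 5, 0), ((4, 1), 5, 1), ((9, 0), 4, 1),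
    ((4, 1), 11, 0), ((5, 0), 7, 1), ((5, 1), 6, 0), ((5, 1), 7, 0), ((5, 1), 12, 0),
    ((5, 1), 13, 0), ((5, 2), 6, 0), ((5, 2), 11, 0), ((5, 2), 12, 0), ((6, 0), 7, 0),
    ((7, 2), 6, 0), ((6, 0), 9, 1), ((6, 0), 11, 0), ((13, 0), 6, 0), ((13, 1), 6, 0),
    ((9, 0), 7, 0), ((12, 0), 7, 0), ((7, 2), 11, 0), ((12, 0), 7, 2), ((9, 0), 11, 0),
    ((9, 0), 13, 0), ((11, 0), 9, 1), ((9, 1), 12, 0), ((11, 0), 12, 0), ((11, 0), 13, 1),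
    ((12, 0), 13, 0), ((13, 1), 12, 0)],
   [((2, 1), 1, 0), ((1, 0), 2, 2), ((1, 0), 10, 1), ((1, 0), 11, 1), ((1, 2), 3, 1),
    ((4, 1), 1, 2), ((7, 2), 1, 2), ((11, 1), 1, 2), ((1, 2), 13, 1), ((4, 1), 2, 1),
    ((5, 2), 2, 1), ((6, 0), 2, 1), ((7, 2), 2, 1), ((2, 1), 9, 0), ((2, 1), 9, 1),
    ((2, 1), 12, 0), ((2, 1), 13, 1), ((2, 2), 3, 1), ((2, 2), 5, 1), ((2, 2), 6, 0),
    ((2, 2), 9, 0), ((2, 2), 12, 0), ((5, 2), 3, 1), ((5, 1), 4, 1), ((9, 1), 4, 1),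
    ((4, 1), 10, 1), ((6, 0), 5, 1), ((7, 2), 5, 1), ((10, 0), 5, 1), ((10, 1), 5, 1),
    ((12, 0), 5, 1), ((5, 1), 13, 1), ((6, 0), 5, 2), ((5, 2), 10, 0), ((12, 0), 5, 2),
    ((9, 1), 6, 0), ((6, 0), 10, 1), ((9, 1), 7, 2), ((7, 2), 10, 1), ((10, 1), 9, 0),
    ((9, 0), 11, 1), ((10, 0), 9, 1), ((11, 1), 9, 1), ((12, 0), 9, 1), ((13, 1), 9, 1),
    ((10, 0), 11, 1), ((10, 1), 11, 1), ((10, 1), 12, 0), ((10, 1), 13, 1)],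
   [((3, 1), 1, 1), ((3, 2), 1, 1), ((11, 1), 1, 1), ((12, 1), 1, 1), ((2, 1), 1, 2),
    ((3, 1), 1, 2), ((6, 1), 1, 2), ((3, 0), 2, 1), ((5, 0), 2, 1), ((6, 2), 2, 1), ((9, 0), 2, 1),
    ((9, 1), 2, 1), ((12, 0), 2, 1), ((12, 1), 2, 1), ((3, 0), 3, 2), ((3, 0), 6, 2),
    ((3, 0), 10, 1), ((3, 0), 11, 1), ((9, 1), 3, 1), ((3, 1), 10, 1), ((3, 2), 5, 0),
    ((3, 2), 6, 1), ((3, 2), 9, 0), ((3, 2), 12, 0), ((5, 0), 6, 1), ((5, 0), 11, 1),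
    ((5, 0), 12, 1), ((6, 1), 6, 2), ((9, 0), 6, 1), ((9, 1), 6, 1), ((6, 1), 11, 0),
    ((11, 1), 6, 1), ((6, 2), 11, 0), ((6, 2), 12, 0), ((11, 1), 9, 0), ((12, 1), 9, 0),
    ((11, 0), 10, 1), ((12, 0), 10, 1), ((11, 0), 12, 1), ((12, 0), 11, 1)],
   [((3, 1), 2, 0), ((2, 0), 4, 1), ((7, 2), 2, 0), ((11, 1), 2, 0), ((13, 1), 2, 0),
    ((3, 0), 3, 1), ((3, 2), 3, 0), ((11, 1), 3, 0), ((3, 0), 12, 1), ((3, 2), 3, 1),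
    ((3, 1), 4, 0), ((3, 1), 6, 2), ((7, 2), 3, 1), ((10, 0), 3, 1), ((10, 1), 3, 1),
    ((13, 0), 3, 1), ((13, 1), 3, 1), ((3, 2), 4, 0), ((4, 1), 3, 2), ((3, 2), 11, 0),
    ((13, 0), 3, 2), ((4, 0), 11, 1), ((4, 0), 12, 1), ((4, 1), 6, 2), ((10, 0), 4, 1),
    ((10, 1), 4, 1), ((11, 0), 4, 1), ((11, 1), 4, 1), ((7, 2), 6, 2), ((11, 1), 6, 2),
    ((13, 1), 6, 2), ((10, 0), 7, 2), ((10, 1), 7, 2), ((11, 0), 7, 2), ((12, 1), 7, 2),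
    ((11, 1), 10, 0), ((13, 1), 10, 0), ((11, 1), 10, 1), ((13, 1), 10, 1), ((12, 1), 11, 0),
    ((13, 1), 11, 0), ((12, 1), 11, 1), ((13, 0), 11, 1), ((13, 0), 12, 1), ((13, 1), 12, 1)]]

/-- The binary number whose digits record the parities of the multiplicities in a list. -/
def parityMask (l : List ℕ) : ℕ := l.foldr (fun k m => 2 ^ k ^^^ m) 0

theorem testBit_parityMask (l : List ℕ) (k : ℕ) :
    (parityMask l).testBit k = decide (Odd (l.count k)) := by
  induction l with
  | nil => simp [parityMask]
  | cons a l ih =>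
    have h : parityMask (a :: l) = 2 ^ a ^^^ parityMask l := rfl
    rw [h, Nat.testBit_xor, ih, Nat.testBit_two_pow, List.count_cons]
    by_cases hak : a = k
    · simp only [hak, decide_true, Bool.true_xor, BEq.rfl, if_true, Nat.odd_add_one,
        decide_not]
    · simp [hak]

theorem even_count_of_parityMask_eq_zero {α : Type*} [BEq α] [LawfulBEq α] {code : α → ℕ}
    (hcode : Function.Injective code) {l : List α} (h : parityMask (l.map code) = 0) (x : α) :
    Even (l.count x) := by
  have h1 := testBit_parityMask (l.map code) (code x)
  rw [h, Nat.zero_testBit, eq_comm, decide_eq_false_iff_not, Nat.not_odd_iff_even,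
    List.count_map_of_injective _ _ hcode] at h1
  exact h1

/-- An injective numbering of the incidences in `G6_98 □ cycleGraph 3`. -/
def incidenceCode (x : (Fin 14 × Fin 3) × Fin 6 × Fin 3) : ℕ :=
  ((3 * x.1.1 + x.1.2) * 6 + x.2.1) * 3 + x.2.2

theorem incidenceCode_injective : Function.Injective incidenceCode := by
  rintro ⟨⟨a, b⟩, c, d⟩ ⟨⟨a', b'⟩, c', d'⟩ h
  simp only [incidenceCode] at h
  simp only [Prod.mk.injEq, Fin.ext_iff]
  omega

theorem isOddCheck_of_mem {K : List ((Fin 14 × Fin 3) × Fin 14 × Fin 3)} (hK : K ∈ oddChecks) :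
    IsOddCheck windowRank labelSrc labelTgt K := by
  have h : ∀ K ∈ oddChecks,
      parityMask ((incidences labelSrc labelTgt K).map incidenceCode) = 0 ∧
        Odd ((K.map (interleaving windowRank labelSrc labelTgt)).sum) := by
    decide +kernel
  refine ⟨fun x _ => ?_, (h K hK).2⟩
  convert even_count_of_parityMask_eq_zero incidenceCode_injective (h K hK).1 x

/-- Whether an edge of the window stands for a walk around the whole cycle. -/
def wraps (w : Fin 14 × Fin 3) : Bool := Nat.ble 8 w.1 && Nat.beq w.2 2

/-- A key that separates the edges of distinct translates of a pair of edges of the window. -/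
def pairKey (q : (Fin 14 × Fin 3) × Fin 14 × Fin 3) : ℕ :=
  (14 * (q.1.1 : ℕ) + q.2.1) * 6 +
    bif wraps q.1 || wraps q.2 then 0 else (q.1.2 : ℕ) + 3 - q.2.2

/-- The end points of the two edges are distinct, and in distinct rows if one of them wraps. -/
def separated (q : (Fin 14 × Fin 3) × Fin 14 × Fin 3) : Bool :=
  [labelSrc q.1, labelTgt q.1].all fun u => [labelSrc q.2, labelTgt q.2].all fun v =>
    !Nat.beq (windowRank u) (windowRank v) &&
      (!(wraps q.1 || wraps q.2) || !Nat.beq u.1 v.1)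

/-- A decision procedure for `List.Nodup` on lists of natural numbers avoiding the digits
of `m`. -/
def nodupFrom : List ℕ → ℕ → Bool
  | [], _ => true
  | k :: l, m => !m.testBit k && nodupFrom l (2 ^ k ||| m)

theorem nodup_of_nodupFrom {l : List ℕ} {m : ℕ} (h : nodupFrom l m = true) :
    l.Nodup ∧ ∀ k ∈ l, m.testBit k = false := by
  induction l generalizing m with
  | nil => simp
  | cons a l ih =>
    simp only [nodupFrom, Bool.and_eq_true, Bool.not_eq_true'] at h
    obtain ⟨h1, h2⟩ := ih h.2
    simp only [Nat.testBit_or, Bool.or_eq_false_iff, Nat.testBit_two_pow, decide_eq_false_iff_not]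
      at h2
    refine ⟨List.nodup_cons.mpr ⟨fun ha => (h2 a ha).1 rfl, h1⟩, ?_⟩
    simp only [List.mem_cons, forall_eq_or_imp]
    exact ⟨h.1, fun k hk => (h2 k hk).2⟩

theorem separated_of_mem : ∀ q ∈ oddChecks.flatten, separated q ∧ ¬ (wraps q.1 ∧ wraps q.2) ∧
    ((q.1.1 : ℕ) = 8 ↔ wraps q.1) ∧ ((q.2.1 : ℕ) = 8 ↔ wraps q.2) := by
  have h : (oddChecks.flatten.all fun q => separated q && !(wraps q.1 && wraps q.2) &&
      (Nat.beq q.1.1 8 == wraps q.1) && (Nat.beq q.2.1 8 == wraps q.2)) = true := by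
    decide +kernel
  intro q hq
  have hq' := List.all_eq_true.mp h q hq
  simp only [Bool.and_eq_true, beq_iff_eq, Bool.not_eq_true', ← Bool.not_eq_true] at hq'
  obtain ⟨⟨⟨h1, h2⟩, h3⟩, h4⟩ := hq'
  exact ⟨h1, h2, by rw [← h3, Nat.beq_eq], by rw [← h4, Nat.beq_eq]⟩

theorem nodup_pairKey : (oddChecks.flatten.map pairKey).Nodup :=
  (nodup_of_nodupFrom (m := 0) (by decide +kernel)).1

theorem G6_98_adj_iff (a b : Fin 6) : G6_98.Adj a b ↔
    ∃ t : Fin 14, t < 8 ∧ (srcRow t = a ∧ tgtRow t = b ∨ srcRow t = b ∧ tgtRow t = a) := by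
  simp only [G6_98, fromEdgeSet_adj, Set.mem_insert_iff, Set.mem_singleton_iff]
  decide +revert +kernel

theorem srcRow_eq_tgtRow (q : Fin 6) :
    ∃ t : Fin 14, 8 ≤ t ∧ (t : ℕ) = 8 + q ∧ srcRow t = q ∧ tgtRow t = q := by
  decide +revert

theorem tgtRow_eq_srcRow_of_le : ∀ t : Fin 14, 8 ≤ t → tgtRow t = srcRow t := by
  decide

theorem val_rotate {n : ℕ} (i : Fin n) {k : ℕ} (hk : k < n) :
    (rotate i k : ℕ) = if i + k < n then i + k else i + k - n := by
  simp only [rotate]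
  split_ifs with h
  · exact Nat.mod_eq_of_lt h
  · rw [Nat.mod_eq_sub_mod (by omega), Nat.mod_eq_of_lt (by omega)]

theorem rotate_rotate {n : ℕ} (i : Fin n) (k m : ℕ) : rotate (rotate i k) m = rotate i (k + m) := by
  simp [rotate, add_assoc]

theorem rotate_zero {n : ℕ} (i : Fin n) : rotate i 0 = i := by
  simp [rotate, Nat.mod_eq_of_lt i.isLt]

theorem rotate_self {n : ℕ} (i : Fin n) : rotate i n = i := by
  simp [rotate, Nat.mod_eq_of_lt i.isLt]

theorem cycleGraph_adj_iff_rotate {n : ℕ} (hn : 3 ≤ n) (i j : Fin n) :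
    (cycleGraph n).Adj i j ↔ rotate i 1 = j ∨ rotate j 1 = i := by
  rw [cycleGraph_adj', Fin.ext_iff, Fin.ext_iff, val_rotate i (by omega), val_rotate j (by omega)]
  have hi := i.isLt
  have hj := j.isLt
  rcases le_or_gt i j with h | h
  · rw [Fin.sub_val_of_le h]
    rcases h.eq_or_lt with rfl | h
    · rw [Fin.sub_val_of_le le_rfl]
      split_ifs <;> omega
    · rw [Fin.coe_sub_iff_lt.mpr h]
      split_ifs <;> omega
  · rw [Fin.sub_val_of_le h.le, Fin.coe_sub_iff_lt.mpr h]
    split_ifs <;> omega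

theorem adj_labelSrc_labelTgt {n : ℕ} (hn : 3 ≤ n) (l : Fin 14 × Fin n) :
    (G6_98 □ cycleGraph n).Adj (labelSrc l) (labelTgt l) := by
  rw [boxProd_adj, G6_98_adj_iff, cycleGraph_adj_iff_rotate hn]
  simp only [labelSrc, labelTgt]
  by_cases h : l.1 < 8
  · simp only [h, if_true, rotate_zero, and_true]
    exact Or.inl ⟨l.1, h, Or.inl ⟨rfl, rfl⟩⟩
  · simp only [h, if_false, true_or, true_and]
    exact Or.inr (tgtRow_eq_srcRow_of_le _ (not_lt.mp h)).symm

/-- The edge of `G6_98 □ cycleGraph n` with a given label. -/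
def labelEdge {n : ℕ} (hn : 3 ≤ n) (l : Fin 14 × Fin n) : (G6_98 □ cycleGraph n).edgeSet :=
  ⟨s(labelSrc l, labelTgt l), adj_labelSrc_labelTgt hn l⟩

theorem rows_injective : ∀ t t' : Fin 14, (srcRow t = srcRow t' ∧ tgtRow t = tgtRow t' ∨
    srcRow t = tgtRow t' ∧ tgtRow t = srcRow t') → t = t' ∧ (t < 8 → srcRow t ≠ tgtRow t) := by
  decide

theorem rotate_one_ne {n : ℕ} (hn : 3 ≤ n) (i : Fin n) : rotate (rotate i 1) 1 ≠ i := by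
  rw [Ne, Fin.ext_iff, val_rotate _ (by omega), val_rotate _ (by omega)]
  have := i.isLt
  split_ifs <;> omega

theorem labelEdge_injective {n : ℕ} (hn : 3 ≤ n) :
    Function.Injective (labelEdge (n := n) hn) := by
  rintro ⟨t, i⟩ ⟨t', i'⟩ h
  have h1 : s(labelSrc (t, i), labelTgt (t, i)) = s(labelSrc (t', i'), labelTgt (t', i')) :=
    congrArg Subtype.val h
  simp only [labelSrc, labelTgt, Sym2.eq_iff, Prod.mk.injEq] at h1
  obtain ⟨rfl, h2⟩ := rows_injective t t' (by tauto)
  refine Prod.ext rfl ?_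
  rcases h1 with h1 | h1
  · exact h1.1.2
  · by_cases ht : t < 8
    · exact absurd h1.1.1 (h2 ht)
    · simp only [ht, if_false] at h1
      exact absurd (by rw [h1.2.2, ← h1.1.2]) (rotate_one_ne hn i)

theorem labelEdge_surjective {n : ℕ} (hn : 3 ≤ n) :
    Function.Surjective (labelEdge (n := n) hn) := by
  rintro ⟨e, he⟩
  induction e with | _ u v =>
  obtain ⟨a, i⟩ := u
  obtain ⟨b, j⟩ := v
  have he' := he
  rw [mem_edgeSet, boxProd_adj, G6_98_adj_iff, cycleGraph_adj_iff_rotate hn] at he'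
  simp only [labelEdge, Subtype.mk.injEq, labelSrc, labelTgt, Sym2.eq_iff, Prod.exists,
    Prod.mk.injEq]
  rcases he' with ⟨⟨t, ht, h⟩, rfl⟩ | ⟨h, rfl⟩
  · refine ⟨t, i, ?_⟩
    simp only [ht, if_true, rotate_zero]
    tauto
  · obtain ⟨t, ht, -, h1, h2⟩ := srcRow_eq_tgtRow a
    simp only at h h1 h2
    rcases h with h | h
    · refine ⟨t, i, ?_⟩
      simp only [not_lt.mpr ht, if_false]
      tauto
    · refine ⟨t, j, ?_⟩
      simp only [not_lt.mpr ht, if_false]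
      tauto

theorem Drawing.mem_Ioo_or_eq_vertexMap {V : Type*} {G : SimpleGraph V} (D : Drawing G)
    (e : G.edgeSet) {s : ℝ} (hs : s ∈ Set.Icc (0 : ℝ) 1) :
    s ∈ Set.Ioo (0 : ℝ) 1 ∨ ∃ u ∈ (e : Sym2 V), D.arc e s = D.vertexMap u := by
  obtain ⟨u, v, he, h0, h1⟩ := D.arc_endpoints e
  rcases hs.1.eq_or_lt with rfl | h
  · exact Or.inr ⟨u, he ▸ Sym2.mem_mk_left u v, h0⟩
  rcases hs.2.eq_or_lt with rfl | h'
  · exact Or.inr ⟨v, he ▸ Sym2.mem_mk_right u v, h1⟩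
  exact Or.inl ⟨h, h'⟩

theorem Drawing.exists_mem_crossings {V : Type*} {G : SimpleGraph V} (D : Drawing G)
    {e f : G.edgeSet} (hef : ∀ u ∈ (e : Sym2 V), ∀ v ∈ (f : Sym2 V), u ≠ v)
    (h : ¬ Disjoint (D.arc e '' Set.Icc 0 1) (D.arc f '' Set.Icc 0 1)) :
    ∃ x, (s(e, f), x) ∈ D.crossings := by
  obtain ⟨_, ⟨s, hs, rfl⟩, ⟨t, ht, hst⟩⟩ := Set.not_disjoint_iff.mp h
  have hne : e ≠ f := by
    rintro rfl
    obtain ⟨u, v, he, -⟩ := D.arc_endpoints e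
    have hu : u ∈ (e : Sym2 V) := he ▸ Sym2.mem_mk_left u v
    exact hef u hu u hu rfl
  rcases D.mem_Ioo_or_eq_vertexMap e hs with hs' | ⟨u, hu, hsu⟩
  · rcases D.mem_Ioo_or_eq_vertexMap f ht with ht' | ⟨v, -, htv⟩
    · exact ⟨D.arc e s, e, f, hne, rfl, ⟨s, hs', rfl⟩, ⟨t, ht', hst⟩⟩
    · exact absurd (hst.symm.trans htv) (D.arc_avoids_vertices e s hs' v)
  · rcases D.mem_Ioo_or_eq_vertexMap f ht with ht' | ⟨v, hv, htv⟩
    · exact absurd (hst.trans hsu) (D.arc_avoids_vertices f t ht' u)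
    · exact absurd (D.vertexMap_injective (hsu.symm.trans (hst.symm.trans htv))) (hef u hu v hv)

theorem Drawing.joinedIn_arc {V : Type*} {G : SimpleGraph V} (D : Drawing G) {u v : V}
    (h : s(u, v) ∈ G.edgeSet) :
    JoinedIn (D.arc ⟨s(u, v), h⟩ '' Set.Icc 0 1) (D.vertexMap u) (D.vertexMap v) := by
  have hpath : IsPathConnected (D.arc ⟨s(u, v), h⟩ '' Set.Icc 0 1) :=
    ((convex_Icc (0 : ℝ) 1).isPathConnected (Set.nonempty_Icc.mpr zero_le_one)).image'
      (D.arc_continuousOn _)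
  have h0 := Set.mem_image_of_mem (D.arc ⟨s(u, v), h⟩) (Set.left_mem_Icc.mpr zero_le_one)
  have h1 := Set.mem_image_of_mem (D.arc ⟨s(u, v), h⟩) (Set.right_mem_Icc.mpr zero_le_one)
  obtain ⟨a, b, hab, ha, hb⟩ := D.arc_endpoints ⟨s(u, v), h⟩
  rw [ha] at h0
  rw [hb] at h1
  rcases Sym2.eq_iff.mp hab with ⟨rfl, rfl⟩ | ⟨rfl, rfl⟩
  · exact hpath.joinedIn _ h0 _ h1
  · exact hpath.joinedIn _ h1 _ h0

/-- The translate by `i` of the window on three consecutive layers. -/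
def windowVertex {n : ℕ} (i : Fin n) (v : Fin 6 × Fin 3) : Fin 6 × Fin n := (v.1, rotate i v.2)

theorem windowVertex_injective {n : ℕ} (hn : 3 ≤ n) (i : Fin n) :
    Function.Injective (windowVertex i) := by
  rintro ⟨a, o⟩ ⟨b, o'⟩ h
  simp only [windowVertex, Prod.mk.injEq] at h
  refine Prod.ext h.1 (Fin.ext ?_)
  have h' := congrArg Fin.val h.2
  have := o.isLt
  have := o'.isLt
  rw [val_rotate i (by omega), val_rotate i (by omega)] at h'
  dsimp only
  split_ifs at h' <;> omega

/-- The edges represented by an edge of the window translated by `i`. -/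
def windowEdges {n : ℕ} (i : Fin n) (w : Fin 14 × Fin 3) : Set (Fin 14 × Fin n) :=
  {l | l.1 = w.1 ∧ (wraps w = false → l.2 = rotate i w.2)}

theorem labelSrc_eq_windowVertex {n : ℕ} {i : Fin n} {w : Fin 14 × Fin 3} {l : Fin 14 × Fin n}
    (hl : l ∈ windowEdges i w) (hw : wraps w = false) :
    labelSrc l = windowVertex i (labelSrc w) := by
  simp [labelSrc, windowVertex, hl.1, hl.2 hw]

theorem wraps_iff (w : Fin 14 × Fin 3) : wraps w = true ↔ 8 ≤ w.1 ∧ w.2 = 2 := by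
  simp [wraps, Fin.le_def, Fin.ext_iff]

theorem labelTgt_eq_windowVertex {n : ℕ} {i : Fin n} {w : Fin 14 × Fin 3} {l : Fin 14 × Fin n}
    (hl : l ∈ windowEdges i w) (hw : wraps w = false) :
    labelTgt l = windowVertex i (labelTgt w) := by
  have h := hl.2 hw
  rw [← Bool.not_eq_true, wraps_iff] at hw
  simp only [labelTgt, windowVertex, hl.1, h, rotate_rotate, Prod.mk.injEq, true_and]
  split_ifs with h8
  · rw [rotate_zero, add_zero]
  · rw [val_rotate w.2 (by omega)]
    have := w.2.isLt
    rw [Fin.ext_iff] at hw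
    simp only [not_lt] at h8
    rw [if_pos (by simp only [h8, true_and, Fin.val_two] at hw; omega)]

theorem Drawing.joinedIn_row {n : ℕ} (hn : 3 ≤ n) (D : Drawing (G6_98 □ cycleGraph n))
    {t : Fin 14} (ht : 8 ≤ t) (i : Fin n) (k : ℕ) :
    JoinedIn (⋃ l ∈ {l : Fin 14 × Fin n | l.1 = t}, D.arc (labelEdge hn l) '' Set.Icc 0 1)
      (D.vertexMap (srcRow t, i)) (D.vertexMap (srcRow t, rotate i k)) := by
  have hstep : ∀ j : Fin n,
      JoinedIn (⋃ l ∈ {l : Fin 14 × Fin n | l.1 = t}, D.arc (labelEdge hn l) '' Set.Icc 0 1)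
        (D.vertexMap (srcRow t, j)) (D.vertexMap (srcRow t, rotate j 1)) := by
    intro j
    have h : JoinedIn (D.arc (labelEdge hn (t, j)) '' Set.Icc 0 1)
        (D.vertexMap (labelSrc (t, j))) (D.vertexMap (labelTgt (t, j))) :=
      D.joinedIn_arc (labelEdge hn (t, j)).2
    rw [labelTgt, if_neg (not_lt.mpr ht), tgtRow_eq_srcRow_of_le t ht] at h
    refine JoinedIn.mono h ?_
    exact Set.subset_biUnion_of_mem (u := fun l => D.arc (labelEdge hn l) '' Set.Icc 0 1)
      (show (t, j) ∈ {l : Fin 14 × Fin n | l.1 = t} from rfl)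
  induction k with
  | zero =>
    rw [rotate_zero]
    exact JoinedIn.refl (hstep i).source_mem
  | succ k ih =>
    rw [← rotate_rotate]
    exact ih.trans (hstep _)

theorem Drawing.joinedIn_windowEdges {n : ℕ} (hn : 3 ≤ n) (D : Drawing (G6_98 □ cycleGraph n))
    (i : Fin n) (w : Fin 14 × Fin 3) :
    JoinedIn (⋃ l ∈ windowEdges i w, D.arc (labelEdge hn l) '' Set.Icc 0 1)
      (D.vertexMap (windowVertex i (labelSrc w))) (D.vertexMap (windowVertex i (labelTgt w))) := by
  cases hw : wraps w with
  | false =>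
    have hl : (w.1, rotate i w.2) ∈ windowEdges i w := ⟨rfl, fun _ => rfl⟩
    rw [← labelSrc_eq_windowVertex hl hw, ← labelTgt_eq_windowVertex hl hw]
    exact (D.joinedIn_arc (labelEdge hn _).2).mono
      (Set.subset_biUnion_of_mem (u := fun l => D.arc (labelEdge hn l) '' Set.Icc 0 1) hl)
  | true =>
    have h1 : windowEdges i w = {l : Fin 14 × Fin n | l.1 = w.1} := by
      simp [windowEdges, hw]
    rw [wraps_iff] at hw
    have h2 : labelTgt w = (srcRow w.1, 0) := by
      rw [labelTgt, tgtRow_eq_srcRow_of_le _ hw.1, hw.2, if_neg (not_lt.mpr hw.1)]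
      rfl
    have h3 := D.joinedIn_row hn hw.1 (rotate i 2) (n - 2)
    rw [rotate_rotate, show 2 + (n - 2) = n by omega, rotate_self] at h3
    rw [h1, h2]
    simpa only [windowVertex, labelSrc, hw.2, Fin.val_zero, Fin.val_two, rotate_zero] using h3

theorem ne_of_separated {n : ℕ} (hn : 3 ≤ n) {q : (Fin 14 × Fin 3) × Fin 14 × Fin 3}
    (hq : separated q) {i : Fin n} {l m : Fin 14 × Fin n} (hl : l ∈ windowEdges i q.1)
    (hm : m ∈ windowEdges i q.2) :
    ∀ u ∈ s(labelSrc l, labelTgt l), ∀ v ∈ s(labelSrc m, labelTgt m), u ≠ v := by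
  simp only [separated, List.all_cons, List.all_nil, Bool.and_true, Bool.and_eq_true,
    Bool.not_eq_true', Bool.or_eq_true, ← Bool.not_eq_true, Nat.beq_eq] at hq
  simp only [Sym2.mem_iff, forall_eq_or_imp, forall_eq]
  by_cases hw : wraps q.1 = true ∨ wraps q.2 = true
  · simp only [hw, not_true_eq_false, false_or, ← Fin.ext_iff] at hq
    have hrow : ∀ {u v : Fin 6 × Fin n}, u.1 ≠ v.1 → u ≠ v := fun h h' => h (congrArg Prod.fst h')
    refine ⟨⟨hrow ?_, hrow ?_⟩, hrow ?_, hrow ?_⟩ <;>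
      simp only [labelSrc, labelTgt, hl.1, hm.1] at hq ⊢
    exacts [hq.1.1.2, hq.1.2.2, hq.2.1.2, hq.2.2.2]
  · have hw' : wraps q.1 = false ∧ wraps q.2 = false := by simpa using hw
    have hne : ∀ {u v : Fin 6 × Fin 3}, windowRank u ≠ windowRank v →
        windowVertex i u ≠ windowVertex i v :=
      fun h h' => h (congrArg _ (windowVertex_injective hn i h'))
    rw [labelSrc_eq_windowVertex hl hw'.1, labelSrc_eq_windowVertex hm hw'.2,
      labelTgt_eq_windowVertex hl hw'.1, labelTgt_eq_windowVertex hm hw'.2]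
    exact ⟨⟨hne hq.1.1.1, hne hq.1.2.1⟩, hne hq.2.1.1, hne hq.2.2.1⟩

theorem eq_of_mem_windowEdges {n : ℕ} (hn : 5 ≤ n) {q q' : (Fin 14 × Fin 3) × Fin 14 × Fin 3}
    (hq : q ∈ oddChecks.flatten) (hq' : q' ∈ oddChecks.flatten) {i i' : Fin n}
    {l m : Fin 14 × Fin n} (hl : l ∈ windowEdges i q.1) (hm : m ∈ windowEdges i q.2)
    (hl' : l ∈ windowEdges i' q'.1) (hm' : m ∈ windowEdges i' q'.2) : q = q' ∧ i = i' := by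
  obtain ⟨-, hw, h1, h2⟩ := separated_of_mem q hq
  obtain ⟨-, hw', h1', h2'⟩ := separated_of_mem q' hq'
  have e1 : q.1.1 = q'.1.1 := hl.1.symm.trans hl'.1
  have e2 : q.2.1 = q'.2.1 := hm.1.symm.trans hm'.1
  have w1 : wraps q.1 = wraps q'.1 := by rw [Bool.eq_iff_iff, ← h1, ← h1', e1]
  have w2 : wraps q.2 = wraps q'.2 := by rw [Bool.eq_iff_iff, ← h2, ← h2', e2]
  have hqq : q = q' := by
    refine List.inj_on_of_nodup_map nodup_pairKey hq hq' ?_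
    simp only [pairKey, e1, e2, w1, w2]
    cases hw : wraps q'.1 || wraps q'.2 with
    | true => rfl
    | false =>
      rw [Bool.or_eq_false_iff] at hw
      have r1 := congrArg Fin.val ((hl.2 (w1.trans hw.1)).symm.trans (hl'.2 hw.1))
      have r2 := congrArg Fin.val ((hm.2 (w2.trans hw.2)).symm.trans (hm'.2 hw.2))
      have := q.1.2.isLt
      have := q.2.2.isLt
      have := q'.1.2.isLt
      have := q'.2.2.isLt
      rw [val_rotate _ (by omega), val_rotate _ (by omega)] at r1 r2
      simp only [cond_false, Nat.add_left_cancel_iff]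
      split_ifs at r1 r2 <;> omega
  subst hqq
  refine ⟨rfl, ?_⟩
  have hrot : ∀ o : Fin 3, rotate i o = rotate i' o → i = i' := by
    intro o h
    have h' := congrArg Fin.val h
    have := o.isLt
    rw [val_rotate _ (by omega), val_rotate _ (by omega)] at h'
    refine Fin.ext ?_
    split_ifs at h' <;> omega
  cases h1 : wraps q.1 with
  | false => exact hrot _ ((hl.2 h1).symm.trans (hl'.2 h1))
  | true =>
    have h2 : wraps q.2 = false := by
      rw [← Bool.not_eq_true]
      exact fun h2 => hw ⟨h1, h2⟩
    exact hrot _ ((hm.2 h2).symm.trans (hm'.2 h2))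

theorem windowRank_injective : Function.Injective windowRank := by
  rintro ⟨a, o⟩ ⟨b, o'⟩ h
  simp only [windowRank] at h
  simp only [Prod.mk.injEq, Fin.ext_iff]
  omega

theorem Drawing.exists_mem_crossings_of_mem_oddChecks {n : ℕ} (hn : 3 ≤ n)
    (D : Drawing (G6_98 □ cycleGraph n)) (i : Fin n)
    {K : List ((Fin 14 × Fin 3) × Fin 14 × Fin 3)} (hK : K ∈ oddChecks) :
    ∃ q ∈ K, ∃ l ∈ windowEdges i q.1, ∃ m ∈ windowEdges i q.2, ∃ x,
      (s(labelEdge hn l, labelEdge hn m), x) ∈ D.crossings := by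
  obtain ⟨q, hq, h⟩ := (isOddCheck_of_mem hK).exists_not_disjoint windowRank_injective
    (D.vertexMap_injective.comp (windowVertex_injective hn i)) (D.joinedIn_windowEdges hn i)
  simp only [Set.disjoint_iUnion_left, Set.disjoint_iUnion_right, not_forall] at h
  obtain ⟨m, hm, l, hl, h⟩ := h
  have hsep := (separated_of_mem q (List.mem_flatten.mpr ⟨K, hK, hq⟩)).1
  exact ⟨q, hq, l, hl, m, hm, D.exists_mem_crossings (ne_of_separated hn hsep hl hm) h⟩

theorem card_le_two_mul_ncard {ι α β : Type*} [Fintype ι] {C : Set (Sym2 α × β)} (hC : C.Finite)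
    (f : ι → α × α) (hf : Function.Injective f) (g : ι → β)
    (h : ∀ a, (s((f a).1, (f a).2), g a) ∈ C) : Fintype.card ι ≤ 2 * C.ncard := by
  classical
  rw [Set.ncard_eq_toFinset_card C hC, ← Finset.card_univ]
  refine (Finset.card_le_mul_card_image_of_maps_to (s := Finset.univ) (t := hC.toFinset)
    (f := fun a => (s((f a).1, (f a).2), g a)) (fun a _ => hC.mem_toFinset.mpr (h a)) 2 ?_)
  rintro ⟨z, x⟩ -
  induction z with | _ u v =>
  refine le_trans (Finset.card_le_card_of_injOn f (t := {(u, v), (v, u)}) ?_ hf.injOn)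
    Finset.card_le_two
  intro a ha
  simp only [Finset.coe_filter, Finset.mem_univ, true_and, Set.mem_ofPred_eq, Prod.mk.injEq,
    Sym2.eq_iff] at ha
  simp only [Finset.coe_insert, Finset.coe_singleton, Set.mem_insert_iff, Set.mem_singleton_iff,
    Prod.ext_iff]
  tauto

theorem Drawing.three_mul_le_ncard_crossings {n : ℕ} (hn : 5 ≤ n)
    (D : Drawing (G6_98 □ cycleGraph n)) (hD : D.crossings.Finite) :
    3 * n ≤ D.crossings.ncard := by
  have hn3 : 3 ≤ n := by omega
  have hlen : oddChecks.length = 6 := rfl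
  have h : ∀ a : Fin oddChecks.length × Fin n, ∃ q ∈ oddChecks.get a.1, ∃ l ∈ windowEdges a.2 q.1,
      ∃ m ∈ windowEdges a.2 q.2, ∃ x, (s(labelEdge hn3 l, labelEdge hn3 m), x) ∈ D.crossings :=
    fun a => D.exists_mem_crossings_of_mem_oddChecks hn3 a.2 (List.get_mem _ _)
  choose q hq l hl m hm x hx using h
  have hmem : ∀ a, q a ∈ oddChecks.flatten :=
    fun a => List.mem_flatten.mpr ⟨_, List.get_mem _ _, hq a⟩
  have hinj : Function.Injective fun a => (labelEdge hn3 (l a), labelEdge hn3 (m a)) := by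
    intro a b hab
    simp only [Prod.mk.injEq, (labelEdge_injective hn3).eq_iff] at hab
    obtain ⟨h1, h2⟩ := eq_of_mem_windowEdges hn (hmem a) (hmem b) (hl a) (hm a)
      (hab.1 ▸ hl b) (hab.2 ▸ hm b)
    refine Prod.ext ?_ h2
    by_contra hne
    have hdisj := (List.nodup_flatten.mp nodup_pairKey.of_map).2
    rcases lt_or_gt_of_ne hne with h | h
    · exact List.pairwise_iff_get.mp hdisj _ _ h (hq a) (h1 ▸ hq b)
    · exact List.pairwise_iff_get.mp hdisj _ _ h (hq b) (h1 ▸ hq a)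
  have := card_le_two_mul_ncard hD _ hinj x hx
  simp only [Fintype.card_prod, Fintype.card_fin, hlen] at this
  omega

/-- The covering map of the punctured plane by the plane that wraps the `x`-axis around a circle
with period `n`. -/
noncomputable def wrapPlane (n : ℕ) (z : ℝ × ℝ) : ℝ × ℝ :=
  Complex.equivRealProdCLM (Complex.exp (z.2 + 2 * Real.pi * z.1 / n * Complex.I))

theorem continuous_wrapPlane (n : ℕ) : Continuous (wrapPlane n) := by
  unfold wrapPlane
  fun_prop

theorem wrapPlane_eq_iff {n : ℕ} (hn : n ≠ 0) {z w : ℝ × ℝ} :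
    wrapPlane n z = wrapPlane n w ↔ z.2 = w.2 ∧ ∃ k : ℤ, z.1 = w.1 + k * n := by
  have hn' : (n : ℝ) ≠ 0 := Nat.cast_ne_zero.mpr hn
  have hpi := Real.pi_ne_zero
  have hcast : ∀ z : ℝ × ℝ, (z.2 + 2 * Real.pi * z.1 / n * Complex.I : ℂ) =
      (z.2 : ℂ) + ((2 * Real.pi * z.1 / n : ℝ) : ℂ) * Complex.I := by
    intro z
    push_cast
    rfl
  have hk : ∀ k : ℤ, (k * (2 * Real.pi * Complex.I) : ℂ) =
      ((k * (2 * Real.pi) : ℝ) : ℂ) * Complex.I := by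
    intro k
    push_cast
    ring
  rw [wrapPlane, wrapPlane, Complex.equivRealProdCLM.injective.eq_iff,
    Complex.exp_eq_exp_iff_exists_int]
  simp only [hcast, hk, Complex.ext_iff, Complex.add_re, Complex.add_im, Complex.re_ofReal_mul,
    Complex.im_ofReal_mul, Complex.I_re, Complex.I_im, Complex.ofReal_re, Complex.ofReal_im,
    mul_zero, mul_one, add_zero, zero_add, exists_and_left]
  refine and_congr_right fun _ => exists_congr fun k => ?_
  field_simp

theorem eq_rotate_of_cast_eq {n : ℕ} {i j : Fin n} {c : ℕ} {k : ℤ}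
    (h : (j : ℝ) = i + c + k * n) : j = rotate i c := by
  have h1 : (j : ℤ) = i + c + k * n := by exact_mod_cast h
  refine Fin.ext ?_
  have h2 : ((j : ℕ) : ℤ) % n = ((i + c : ℕ) : ℤ) % n := by
    rw [h1]
    push_cast
    rw [Int.add_mul_emod_self_right]
  rw [← Nat.mod_eq_of_lt j.isLt]
  exact_mod_cast h2

theorem exists_cast_rotate_eq {n : ℕ} (i : Fin n) (c : ℕ) :
    ∃ k : ℤ, ((i : ℝ) + c : ℝ) = (rotate i c : ℕ) + k * n := by
  refine ⟨((i + c) / n : ℕ), ?_⟩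
  have h := congrArg (Nat.cast : ℕ → ℝ) (Nat.mod_add_div (i + c) n)
  simp only [rotate]
  generalize (i + c) / n = d at h ⊢
  push_cast at h ⊢
  linarith

/-- The direction in which a chord bends in the drawing. -/
def bend (t : Fin 14) : ℤ := ![0, 0, 0, 0, 0, 1, -1, 1, 0, 0, 0, 0, 0, 0] t

/-- The horizontal displacement along an edge. -/
noncomputable def displacement (t : Fin 14) (s : ℝ) : ℝ :=
  if t < 8 then bend t * (s * (1 - s)) else s

/-- The height along an edge. -/
noncomputable def height (t : Fin 14) (s : ℝ) : ℝ :=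
  (srcRow t : ℕ) + ((tgtRow t : ℕ) - (srcRow t : ℕ)) * s

/-- The arc of an edge in the drawing. -/
noncomputable def labelArc {n : ℕ} (l : Fin 14 × Fin n) (s : ℝ) : ℝ × ℝ :=
  wrapPlane n (l.2 + displacement l.1 s, height l.1 s)

/-- The position of a vertex in the drawing. -/
noncomputable def vertexPoint {n : ℕ} (v : Fin 6 × Fin n) : ℝ × ℝ :=
  wrapPlane n ((v.2 : ℕ), (v.1 : ℕ))

theorem continuous_labelArc {n : ℕ} (l : Fin 14 × Fin n) : Continuous (labelArc l) := by
  refine (continuous_wrapPlane n).comp ?_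
  have : Continuous (displacement l.1) := by
    unfold displacement
    split_ifs <;> fun_prop
  unfold height
  fun_prop

theorem vertexPoint_injective (n : ℕ) : Function.Injective (vertexPoint (n := n)) := by
  intro u v h
  have hn : n ≠ 0 := by
    have := u.2.isLt
    omega
  obtain ⟨h1, k, h2⟩ := (wrapPlane_eq_iff hn).mp h
  refine Prod.ext (Fin.ext (Nat.cast_injective h1)) ?_
  rw [eq_rotate_of_cast_eq (i := v.2) (j := u.2) (c := 0) (k := k) (by simpa using h2),
    rotate_zero]

theorem labelArc_zero {n : ℕ} (l : Fin 14 × Fin n) : labelArc l 0 = vertexPoint (labelSrc l) := by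
  simp [labelArc, vertexPoint, labelSrc, displacement, height]

theorem labelArc_one {n : ℕ} (l : Fin 14 × Fin n) : labelArc l 1 = vertexPoint (labelTgt l) := by
  have hn : n ≠ 0 := by
    have := l.2.isLt
    omega
  rw [labelArc, vertexPoint, wrapPlane_eq_iff hn]
  refine ⟨by simp [height, labelTgt], ?_⟩
  obtain ⟨k, hk⟩ := exists_cast_rotate_eq l.2 (if l.1 < 8 then 0 else 1)
  refine ⟨k, ?_⟩
  simp only [labelTgt, displacement]
  rw [← hk]
  split_ifs <;> simp

theorem rows_of_lt : ∀ t : Fin 14, t < 8 →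
    (tgtRow t : ℕ) = srcRow t + 1 ∧ bend t = 0 ∨
      (tgtRow t : ℕ) = srcRow t + 2 ∧ (bend t = 1 ∨ bend t = -1) := by
  decide

theorem srcRow_lt_tgtRow {t : Fin 14} (ht : t < 8) : (srcRow t : ℕ) < tgtRow t := by
  rcases rows_of_lt t ht with h | h <;> omega

theorem height_of_le {t : Fin 14} (ht : 8 ≤ t) (s : ℝ) : height t s = (srcRow t : ℕ) := by
  simp [height, tgtRow_eq_srcRow_of_le t ht]

theorem height_mem_Ioo {t : Fin 14} (ht : t < 8) {s : ℝ} (hs : s ∈ Set.Ioo (0 : ℝ) 1) :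
    ((srcRow t : ℕ) : ℝ) < height t s ∧ height t s < (tgtRow t : ℕ) := by
  have h : ((srcRow t : ℕ) : ℝ) < (tgtRow t : ℕ) := Nat.cast_lt.mpr (srcRow_lt_tgtRow ht)
  unfold height
  constructor <;> nlinarith [hs.1, hs.2]

theorem labelArc_injOn {n : ℕ} (hn : 3 ≤ n) (l : Fin 14 × Fin n) :
    Set.InjOn (labelArc l) (Set.Icc 0 1) := by
  intro s hs s' hs' h
  obtain ⟨h1, k, h2⟩ := (wrapPlane_eq_iff (by omega)).mp h
  by_cases ht : l.1 < 8
  · have hne : ((tgtRow l.1 : ℕ) - (srcRow l.1 : ℕ) : ℝ) ≠ 0 :=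
      sub_ne_zero.mpr (Nat.cast_injective.ne (srcRow_lt_tgtRow ht).ne')
    simp only [height] at h1
    exact mul_left_cancel₀ hne (add_left_cancel h1)
  · simp only [displacement, ht, if_false] at h2
    have hn' : (3 : ℝ) ≤ n := by exact_mod_cast hn
    have hk : k = 0 := by
      by_contra hk
      rcases lt_or_gt_of_ne hk with hk | hk
      · have : (k : ℝ) ≤ -1 := by exact_mod_cast (by omega : k ≤ -1)
        nlinarith [hs.1, hs'.2]
      · have : (1 : ℝ) ≤ k := by exact_mod_cast (by omega : 1 ≤ k)
        nlinarith [hs'.1, hs.2]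
    simpa [hk] using h2

theorem eq_half_of_height_eq_natCast {t : Fin 14} (ht : t < 8) {s : ℝ}
    (hs : s ∈ Set.Ioo (0 : ℝ) 1) {q : ℕ} (h : height t s = q) :
    s = 1 / 2 ∧ q = srcRow t + 1 ∧ (tgtRow t : ℕ) = srcRow t + 2 ∧ (bend t = 1 ∨ bend t = -1) := by
  obtain ⟨h1, h2⟩ := height_mem_Ioo ht hs
  rw [h, Nat.cast_lt] at h1 h2
  rcases rows_of_lt t ht with h3 | h3
  · omega
  · have hq : q = srcRow t + 1 := by omega
    refine ⟨?_, hq, h3⟩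
    rw [height, hq, h3.1] at h
    push_cast at h
    linarith

theorem Int.eq_zero_of_cast_mem_Ioo {m : ℤ} (h1 : (-1 : ℝ) < m) (h2 : (m : ℝ) < 1) : m = 0 := by
  have h1' : -1 < m := by exact_mod_cast h1
  have h2' : m < 1 := by exact_mod_cast h2
  omega

theorem labelArc_ne_vertexPoint {n : ℕ} (l : Fin 14 × Fin n) {s : ℝ}
    (hs : s ∈ Set.Ioo (0 : ℝ) 1) (v : Fin 6 × Fin n) : labelArc l s ≠ vertexPoint v := by
  intro h
  have hn : n ≠ 0 := by
    have := v.2.isLt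
    omega
  obtain ⟨h1, k, h2⟩ := (wrapPlane_eq_iff hn).mp h
  have hfrac : ∀ m : ℤ, displacement l.1 s ≠ m := by
    intro m hm
    by_cases ht : l.1 < 8
    · obtain ⟨rfl, -, -, hb⟩ := eq_half_of_height_eq_natCast ht hs h1
      simp only [displacement, ht, if_true] at hm
      rcases hb with hb | hb
      all_goals
        rw [hb] at hm
        have : m = 0 := Int.eq_zero_of_cast_mem_Ioo (by rw [← hm]; norm_num) (by rw [← hm]; norm_num)
        norm_num [this] at hm
    · simp only [displacement, ht, if_false] at hm
      have : m = 0 := Int.eq_zero_of_cast_mem_Ioo (by linarith [hs.1]) (by linarith [hs.2])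
      simp only [this, Int.cast_zero] at hm
      exact hs.1.ne' hm
  refine hfrac (v.2 + k * n - l.2) ?_
  push_cast
  simp only at h2
  linarith

theorem rows_separated : ∀ t t' : Fin 14, t < 8 → t' < 8 → t ≠ t' → bend t = bend t' →
    (tgtRow t : ℕ) ≤ srcRow t' ∨ (tgtRow t' : ℕ) ≤ srcRow t := by
  decide

theorem displacement_ne {t t' : Fin 14} (ht : t < 8) (ht' : t' < 8) (hb : bend t ≠ bend t')
    {s s' : ℝ} (hs : s ∈ Set.Ioo (0 : ℝ) 1) (hs' : s' ∈ Set.Ioo (0 : ℝ) 1) :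
    displacement t s ≠ displacement t' s' := by
  have hw : 0 < s * (1 - s) := mul_pos hs.1 (sub_pos.mpr hs.2)
  have hw' : 0 < s' * (1 - s') := mul_pos hs'.1 (sub_pos.mpr hs'.2)
  simp only [displacement, ht, ht', if_true]
  have h3 : bend t = 0 ∨ bend t = 1 ∨ bend t = -1 := by
    rcases rows_of_lt t ht with h | h <;> tauto
  have h4 : bend t' = 0 ∨ bend t' = 1 ∨ bend t' = -1 := by
    rcases rows_of_lt t' ht' with h | h <;> tauto
  rcases h3 with h | h | h <;> rcases h4 with h' | h' | h' <;> rw [h, h'] at hb ⊢ <;>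
    first
    | exact absurd rfl hb
    | (push_cast; intro; linarith)

theorem abs_displacement_lt {t : Fin 14} (ht : t < 8) (s : ℝ) (hs : s ∈ Set.Ioo (0 : ℝ) 1) :
    |displacement t s| < 1 / 2 := by
  have hw : 0 < s * (1 - s) := mul_pos hs.1 (sub_pos.mpr hs.2)
  have hw' : s * (1 - s) < 1 / 2 := by nlinarith [sq_nonneg (s - 1 / 2)]
  simp only [displacement, ht, if_true]
  have h3 : bend t = 0 ∨ bend t = 1 ∨ bend t = -1 := by
    rcases rows_of_lt t ht with h | h <;> tauto
  rw [abs_lt]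
  rcases h3 with h | h | h <;> rw [h] <;> push_cast <;> constructor <;> linarith

/-- The three chords. -/
def chord (c : Fin 3) : Fin 14 := ![5, 6, 7] c

/-- The link crossed by a chord. -/
def crossedLink (c : Fin 3) : Fin 14 := ![10, 11, 12] c

/-- The number of steps from a link to the layer of the chord that crosses it. -/
def chordOffset (c : Fin 3) : ℕ := ![0, 1, 0] c

theorem exists_chord : ∀ t t' : Fin 14, t < 8 → 8 ≤ t' → (tgtRow t : ℕ) = srcRow t + 2 →
    (srcRow t' : ℕ) = srcRow t + 1 →
    ∃ c, t = chord c ∧ t' = crossedLink c ∧ bend t = 1 - 2 * chordOffset c ∧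
      (chordOffset c = 0 ∨ chordOffset c = 1) := by
  decide

theorem eq_of_labelArc_eq_of_lt_of_lt {n : ℕ} {l l' : Fin 14 × Fin n} (hl : l.1 < 8)
    (hl' : l'.1 < 8) {s s' : ℝ} (hs : s ∈ Set.Ioo (0 : ℝ) 1) (hs' : s' ∈ Set.Ioo (0 : ℝ) 1)
    (h : labelArc l s = labelArc l' s') : l = l' := by
  have hn : n ≠ 0 := by
    have := l.2.isLt
    omega
  obtain ⟨h1, k, h2⟩ := (wrapPlane_eq_iff hn).mp h
  simp only at h1 h2
  have hd := abs_lt.mp (abs_displacement_lt hl s hs)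
  have hd' := abs_lt.mp (abs_displacement_lt hl' s' hs')
  have hm : (l.2 - l'.2 - k * n : ℤ) = 0 := by
    refine Int.eq_zero_of_cast_mem_Ioo ?_ ?_ <;> push_cast <;> linarith
  have hm' : (l.2 : ℝ) - l'.2 - k * n = 0 := by exact_mod_cast hm
  have hj : l.2 = l'.2 := by
    rw [eq_rotate_of_cast_eq (i := l'.2) (j := l.2) (c := 0) (k := k) (by push_cast; linarith),
      rotate_zero]
  refine Prod.ext ?_ hj
  by_contra ht
  by_cases hb : bend l.1 = bend l'.1
  · have b1 := height_mem_Ioo hl hs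
    have b2 := height_mem_Ioo hl' hs'
    rcases rows_separated _ _ hl hl' ht hb with h3 | h3
    all_goals
      have : ((_ : ℕ) : ℝ) ≤ (_ : ℕ) := Nat.cast_le.mpr h3
      linarith [b1.1, b1.2, b2.1, b2.2]
  · exact displacement_ne hl hl' hb hs hs' (by linarith)

theorem eq_of_labelArc_eq_of_le_of_le {n : ℕ} {l l' : Fin 14 × Fin n} (hl : 8 ≤ l.1)
    (hl' : 8 ≤ l'.1) {s s' : ℝ} (hs : s ∈ Set.Ioo (0 : ℝ) 1) (hs' : s' ∈ Set.Ioo (0 : ℝ) 1)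
    (h : labelArc l s = labelArc l' s') : l = l' := by
  have hn : n ≠ 0 := by
    have := l.2.isLt
    omega
  obtain ⟨h1, k, h2⟩ := (wrapPlane_eq_iff hn).mp h
  simp only [displacement, hl.not_gt, hl'.not_gt, if_false] at h2
  rw [height_of_le hl, height_of_le hl', Nat.cast_inj] at h1
  have hm : (l.2 - l'.2 - k * n : ℤ) = 0 := by
    refine Int.eq_zero_of_cast_mem_Ioo ?_ ?_ <;> push_cast <;> linarith [hs.1, hs.2, hs'.1, hs'.2]
  have hm' : (l.2 : ℝ) - l'.2 - k * n = 0 := by exact_mod_cast hm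
  refine Prod.ext (rows_injective _ _ (Or.inl ?_)).1 ?_
  · rw [tgtRow_eq_srcRow_of_le _ hl, tgtRow_eq_srcRow_of_le _ hl']
    exact ⟨Fin.ext h1, Fin.ext h1⟩
  · rw [eq_rotate_of_cast_eq (i := l'.2) (j := l.2) (c := 0) (k := k) (by push_cast; linarith),
      rotate_zero]

theorem exists_chord_of_labelArc_eq {n : ℕ} {l l' : Fin 14 × Fin n} (hl : l.1 < 8)
    (hl' : 8 ≤ l'.1) {s s' : ℝ} (hs : s ∈ Set.Ioo (0 : ℝ) 1) (hs' : s' ∈ Set.Ioo (0 : ℝ) 1)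
    (h : labelArc l s = labelArc l' s') : s = 1 / 2 ∧ ∃ c,
      l = (chord c, rotate l'.2 (chordOffset c)) ∧ l' = (crossedLink c, l'.2) := by
  have hn : n ≠ 0 := by
    have := l.2.isLt
    omega
  obtain ⟨h1, k, h2⟩ := (wrapPlane_eq_iff hn).mp h
  rw [height_of_le hl'] at h1
  obtain ⟨rfl, h3, h4, -⟩ := eq_half_of_height_eq_natCast hl hs h1
  obtain ⟨c, hc, hc', hb, hoff⟩ := exists_chord _ _ hl hl' h4 h3
  refine ⟨rfl, c, Prod.ext hc ?_, Prod.ext hc' rfl⟩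
  simp only [displacement, hl, hl'.not_gt, if_true, if_false, hb] at h2
  refine eq_rotate_of_cast_eq (k := k) ?_
  have hm : (l.2 - l'.2 - chordOffset c - k * n : ℤ) = 0 := by
    refine Int.eq_zero_of_cast_mem_Ioo ?_ ?_ <;> push_cast at h2 ⊢ <;>
      rcases hoff with h | h <;> rw [h] at h2 ⊢ <;> push_cast at h2 ⊢ <;>
        linarith [hs'.1, hs'.2]
  have hm' : (l.2 : ℝ) - l'.2 - chordOffset c - k * n = 0 := by exact_mod_cast hm
  linarith

/-- The label of an edge. -/
noncomputable def edgeLabel {n : ℕ} (hn : 3 ≤ n) (e : (G6_98 □ cycleGraph n).edgeSet) :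
    Fin 14 × Fin n :=
  Function.surjInv (labelEdge_surjective hn) e

theorem labelEdge_edgeLabel {n : ℕ} (hn : 3 ≤ n) (e : (G6_98 □ cycleGraph n).edgeSet) :
    labelEdge hn (edgeLabel hn e) = e :=
  Function.surjInv_eq (labelEdge_surjective hn) e

/-- The drawing with rows on concentric circles in which only the chords cross links. -/
noncomputable def circularDrawing {n : ℕ} (hn : 3 ≤ n) : Drawing (G6_98 □ cycleGraph n) where
  vertexMap := vertexPoint
  vertexMap_injective := vertexPoint_injective n
  arc e := labelArc (edgeLabel hn e)
  arc_continuousOn _ := (continuous_labelArc _).continuousOn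
  arc_injOn _ := labelArc_injOn hn _
  arc_endpoints e := ⟨_, _, congrArg Subtype.val (labelEdge_edgeLabel hn e).symm,
    labelArc_zero _, labelArc_one _⟩
  arc_avoids_vertices _ _ ht w := labelArc_ne_vertexPoint _ ht w

/-- The crossing of a chord with a link in the circular drawing. -/
noncomputable def chordCrossing {n : ℕ} (hn : 3 ≤ n) (a : Fin 3 × Fin n) :
    Sym2 (G6_98 □ cycleGraph n).edgeSet × (ℝ × ℝ) :=
  (s(labelEdge hn (chord a.1, rotate a.2 (chordOffset a.1)), labelEdge hn (crossedLink a.1, a.2)),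
    labelArc (chord a.1, rotate a.2 (chordOffset a.1)) (1 / 2))

theorem crossings_circularDrawing_subset {n : ℕ} (hn : 3 ≤ n) :
    (circularDrawing hn).crossings ⊆ Set.range (chordCrossing hn) := by
  have key : ∀ e f : (G6_98 □ cycleGraph n).edgeSet, ∀ s ∈ Set.Ioo (0 : ℝ) 1,
      ∀ t ∈ Set.Ioo (0 : ℝ) 1, labelArc (edgeLabel hn e) s = labelArc (edgeLabel hn f) t →
      (edgeLabel hn e).1 < 8 → 8 ≤ (edgeLabel hn f).1 →
      (s(e, f), labelArc (edgeLabel hn e) s) ∈ Set.range (chordCrossing hn) := by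
    intro e f s hs t ht h he hf
    obtain ⟨rfl, c, h1, h2⟩ := exists_chord_of_labelArc_eq he hf hs ht h
    refine ⟨(c, (edgeLabel hn f).2), ?_⟩
    simp only [chordCrossing]
    rw [← h1, ← h2, labelEdge_edgeLabel, labelEdge_edgeLabel]
  rintro ⟨_, _⟩ ⟨e, f, hne, rfl, ⟨s, hs, rfl⟩, ⟨t, ht, h⟩⟩
  change labelArc (edgeLabel hn f) t = labelArc (edgeLabel hn e) s at h
  have hlabel : edgeLabel hn e ≠ edgeLabel hn f :=
    (Function.injective_surjInv (labelEdge_surjective hn)).ne hne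
  change (s(e, f), labelArc (edgeLabel hn e) s) ∈ _
  rcases lt_or_ge (edgeLabel hn e).1 8 with he | he <;>
    rcases lt_or_ge (edgeLabel hn f).1 8 with hf | hf
  · exact absurd (eq_of_labelArc_eq_of_lt_of_lt he hf hs ht h.symm) hlabel
  · exact key e f s hs t ht h.symm he hf
  · rw [Sym2.eq_swap, ← h]
    exact key f e t ht s hs h hf he
  · exact absurd (eq_of_labelArc_eq_of_le_of_le he hf hs ht h.symm) hlabel

theorem ncard_crossings_circularDrawing_le {n : ℕ} (hn : 3 ≤ n) :
    (circularDrawing hn).crossings.ncard ≤ 3 * n := by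
  refine (Set.ncard_le_ncard (crossings_circularDrawing_subset hn) (Set.finite_range _)).trans ?_
  rw [← Set.image_univ]
  refine (Set.ncard_image_le Set.finite_univ).trans ?_
  rw [Set.ncard_univ, Nat.card_eq_fintype_card, Fintype.card_prod, Fintype.card_fin,
    Fintype.card_fin]

/-- The crossing number of `G⁶₉₈ □ Cₙ` is `3n` for all `n ≥ 5`. -/
theorem crossingNumber_G6_98_boxProd_cycle (n : ℕ) (hn : 5 ≤ n) :
    crossingNumber (G6_98 □ SimpleGraph.cycleGraph n) = 3 * n := by
  have hn3 : 3 ≤ n := by omega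
  have hfin := (Set.finite_range _).subset (crossings_circularDrawing_subset hn3)
  refine le_antisymm ?_ ?_
  · refine le_trans ?_ (ncard_crossings_circularDrawing_le hn3)
    exact Nat.sInf_le ⟨circularDrawing hn3, hfin, rfl⟩
  · refine le_csInf ⟨_, circularDrawing hn3, hfin, rfl⟩ ?_
    rintro _ ⟨D, hD, rfl⟩
    exact D.three_mul_le_ncard_crossings hn hD
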